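/- arXiv:2207.00097 — 11 statements merged into one kernel-verified Lean document; each statement's English description precedes it below -/
import Mathlib

section
/- Let a' denote the arrival-time sequence obtained from initial arrival a₁ + δ with δ ≥ 0, and a the sequence obtained from a₁. Then for every k = 1,…,n one has a_k ≤ a'_k ≤ a_k + δ and max(a_k, O_k) ≤ max(a'_k, O_k) ≤ max(a_k, O_k) + δ. (Propagation of a delay through the itinerary is monotone and 1-Lipschitz.) -/
/-- Arrival times of an itinerary with `n` visits (indexed `0, …, n-1`):
`arrival O T t a1 0 = a1` and
`arrival O T t a1 (k+1) = max (arrival O T t a1 k) (O k) + T k + t k`,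
i.e. `a_{k+1} = z_k + T_k + t_k` with start time `z_k = max(a_k, O_k)`. -/
noncomputable def arrival (O T t : ℕ → ℝ) (a1 : ℝ) : ℕ → ℝ
  | 0 => a1
  | k + 1 => max (arrival O T t a1 k) (O k) + T k + t k

/-- Propagation of a delay `δ ≥ 0` of the initial arrival time through the
itinerary is monotone and 1-Lipschitz, both for arrival times and start times. -/
theorem delay_propagation_monotone_lipschitz
    (n : ℕ) (hn : 1 ≤ n) (O C T t : ℕ → ℝ)
    (hT : ∀ k, 0 ≤ T k) (ht : ∀ k, 0 ≤ t k)
    (a1 δ : ℝ) (hδ : 0 ≤ δ)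
    (k : ℕ) (hk : k < n) :
    (arrival O T t a1 k ≤ arrival O T t (a1 + δ) k ∧
      arrival O T t (a1 + δ) k ≤ arrival O T t a1 k + δ) ∧
    (max (arrival O T t a1 k) (O k) ≤ max (arrival O T t (a1 + δ) k) (O k) ∧
      max (arrival O T t (a1 + δ) k) (O k) ≤ max (arrival O T t a1 k) (O k) + δ) := by
  have step : ∀ x y o : ℝ, x ≤ y → y ≤ x + δ →
      max x o ≤ max y o ∧ max y o ≤ max x o + δ := by
    intro x y o h1 h2
    refine ⟨max_le_max_right o h1, max_le ?_ ?_⟩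
    · linarith [le_max_left x o]
    · linarith [le_max_right x o]
  have key : ∀ j : ℕ, arrival O T t a1 j ≤ arrival O T t (a1 + δ) j ∧
      arrival O T t (a1 + δ) j ≤ arrival O T t a1 j + δ := by
    intro j
    induction j with
    | zero => simp only [arrival]; constructor <;> linarith
    | succ j ih =>
      have h := step _ _ (O j) ih.1 ih.2
      simp only [arrival]
      constructor <;> linarith [h.1, h.2]
  exact ⟨key k, step _ _ (O k) (key k).1 (key k).2⟩
end

section
/- Let a'' denote the arrival-time sequence obtained from initial arrival a₁ − δ with δ ≥ 0, and a the sequence obtained from a₁. Then for every k = 2,…,n one has a''_k = a_k − min(δ, min_{1 ≤ l ≤ k−1} max(0, a_l − O_l)). (A decrease of the initial arrival time propagates to visit k exactly up to the smallest slack max(0, a_l − O_l) over the preceding visits.) -/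
theorem decrease_step (a o d : ℝ) (hd : 0 ≤ d) :
    max (a - d) o = max a o - min d (max 0 (a - o)) := by
  rcases le_total a o with h | h
  · rw [max_eq_right h, max_eq_right (by linarith), max_eq_left (by linarith),
      min_eq_right hd, sub_zero]
  · rw [max_eq_left h, max_eq_right (a := (0 : ℝ)) (by linarith)]
    rcases le_total d (a - o) with h' | h'
    · rw [min_eq_left h', max_eq_left (by linarith)]
    · rw [min_eq_right h', max_eq_right (by linarith)]
      ring

/-- A decrease `δ ≥ 0` of the initial arrival time propagates to visit `k`
(for `k ≥ 1`, i.e. the second visit onwards) exactly up to the smallest slack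
`max(0, a_l − O_l)` over the preceding visits:
`a''_k = a_k − min(δ, min_{l<k} max(0, a_l − O_l))`. -/
theorem decrease_propagation_closed_form
    (n : ℕ) (hn : 1 ≤ n) (O C T t : ℕ → ℝ)
    (hT : ∀ k, 0 ≤ T k) (ht : ∀ k, 0 ≤ t k)
    (a1 δ : ℝ) (hδ : 0 ≤ δ)
    (k : ℕ) (hk1 : 1 ≤ k) (hk : k < n) :
    arrival O T t (a1 - δ) k =
      arrival O T t a1 k -
        min δ
          ((Finset.range k).inf'
            (Finset.nonempty_range_iff.mpr (Nat.one_le_iff_ne_zero.mp hk1))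
            (fun l => max 0 (arrival O T t a1 l - O l))) := by
  clear hk hn
  induction k, hk1 using Nat.le_induction with
  | base =>
    simp only [arrival, Finset.range_one, Finset.inf'_singleton]
    rw [decrease_step _ _ _ hδ]
    ring
  | succ k hk1 ih =>
    have hne : (Finset.range k).Nonempty :=
      Finset.nonempty_range_iff.mpr (Nat.one_le_iff_ne_zero.mp hk1)
    have hnonneg : 0 ≤ (Finset.range k).inf' hne
        (fun l => max 0 (arrival O T t a1 l - O l)) :=
      Finset.le_inf' _ _ (fun l _ => le_max_left _ _)
    have hinf := Finset.inf'_insert (b := k) hne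
      (fun l => max 0 (arrival O T t a1 l - O l))
    simp only [Finset.range_add_one]
    rw [hinf, arrival, arrival, ih, decrease_step _ _ _ (le_min hδ hnonneg), min_assoc,
      min_comm (max 0 (arrival O T t a1 k - O k))]
    ring
end

section
/- Assume the schedule generated by a₁ is feasible (z_k ≤ C_k for all k) and define MaxShift by the backward recursion MaxShift_n = C_n − z_n and MaxShift_k = min(C_k − z_k, Wait_{k+1} + MaxShift_{k+1}) for k < n. Fix k and δ ≥ 0, and consider the delayed schedule defined by z'_k = z_k + δ, a'_{l+1} = z'_l + T_l + t_l and z'_l = max(a'_l, O_l) for l > k. Then z'_l ≤ C_l holds for every l ≥ k if and only if δ ≤ MaxShift_k. (MaxShift_k is exactly the maximum admissible increase of the start time z_k.) -/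
/-- Delayed start times propagated forward from visit `k`:
`startFrom O T t k zk m` is the start time `z'_{k+m}` of the schedule in which
the start time of visit `k` is forced to `zk` and later visits follow the
recursion `a'_{l+1} = z'_l + T_l + t_l`, `z'_{l+1} = max(a'_{l+1}, O_{l+1})`. -/
noncomputable def startFrom (O T t : ℕ → ℝ) (k : ℕ) (zk : ℝ) : ℕ → ℝ
  | 0 => zk
  | m + 1 => max (startFrom O T t k zk m + T (k + m) + t (k + m)) (O (k + m + 1))

theorem startFrom_succ_shift (O T t : ℕ → ℝ) (k : ℕ) (zk : ℝ) (m : ℕ) :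
    startFrom O T t k zk (m + 1) =
      startFrom O T t (k + 1) (max (zk + T k + t k) (O (k + 1))) m := by
  induction m with
  | zero => simp [startFrom]
  | succ m ih =>
    rw [startFrom, ih, startFrom]
    have e : k + (m + 1) = k + 1 + m := by omega
    rw [e]

/-- `MaxShift_k` (defined by the backward recursion `MaxShift_{n-1} = C_{n-1} − z_{n-1}`,
`MaxShift_k = min(C_k − z_k, Wait_{k+1} + MaxShift_{k+1})`) is exactly the maximum
admissible increase `δ ≥ 0` of the start time `z_k` such that all later visits can
still be started before their closing times. -/
theorem maxShift_characterizes_feasible_start_delay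
    (n : ℕ) (hn : 1 ≤ n) (O C T t : ℕ → ℝ)
    (hT : ∀ k, 0 ≤ T k) (ht : ∀ k, 0 ≤ t k) (a1 : ℝ)
    (hfeas : ∀ k, k < n → max (arrival O T t a1 k) (O k) ≤ C k)
    (MS : ℕ → ℝ)
    (hMSlast : MS (n - 1) =
      C (n - 1) - max (arrival O T t a1 (n - 1)) (O (n - 1)))
    (hMSrec : ∀ j, j + 1 < n →
      MS j = min (C j - max (arrival O T t a1 j) (O j))
        (max 0 (O (j + 1) - arrival O T t a1 (j + 1)) + MS (j + 1)))
    (k : ℕ) (hk : k < n) (δ : ℝ) (hδ : 0 ≤ δ) :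
    (∀ l, k ≤ l → l < n →
        startFrom O T t k (max (arrival O T t a1 k) (O k) + δ) (l - k) ≤ C l)
      ↔ δ ≤ MS k := by
  have key : ∀ d k, k + d + 1 = n → 0 ≤ MS k ∧ ∀ δ : ℝ, 0 ≤ δ →
      ((∀ l, k ≤ l → l < n →
        startFrom O T t k (max (arrival O T t a1 k) (O k) + δ) (l - k) ≤ C l)
      ↔ δ ≤ MS k) := by
    intro d
    induction d with
    | zero =>
      intro k hk
      have e : n - 1 = k := by omega
      rw [e] at hMSlast
      have hf := hfeas k (by omega)
      refine ⟨by linarith, fun δ _ => ⟨fun h => ?_, fun h l h1 h2 => ?_⟩⟩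
      · have := h k le_rfl (by omega)
        simp only [Nat.sub_self, startFrom] at this
        linarith
      · have el : l = k := by omega
        subst el
        simp only [Nat.sub_self, startFrom]
        linarith
    | succ d ih =>
      intro k hk
      obtain ⟨h0, hiff⟩ := ih (k + 1) (by omega)
      have hf := hfeas k (by omega)
      have hr := hMSrec k (by omega)
      set w := max 0 (O (k + 1) - arrival O T t a1 (k + 1)) with hw
      have hw0 : 0 ≤ w := le_max_left _ _
      refine ⟨by rw [hr]; exact le_min (by linarith) (by linarith), fun δ hδ => ?_⟩
      have hz : max (max (arrival O T t a1 k) (O k) + δ + T k + t k) (O (k + 1)) =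
          max (arrival O T t a1 (k + 1)) (O (k + 1)) + max 0 (δ - w) := by
        have ha : max (arrival O T t a1 k) (O k) + δ + T k + t k
            = arrival O T t a1 (k + 1) + δ := by
          rw [arrival]; ring
        rw [ha, hw]
        generalize arrival O T t a1 (k + 1) = a
        generalize O (k + 1) = o
        clear * - hδ
        grind
      have h2 := hiff (max 0 (δ - w)) (le_max_left _ _)
      rw [← hz] at h2
      rw [hr, le_min_iff]
      have h3 : δ ≤ w + MS (k + 1) ↔ max 0 (δ - w) ≤ MS (k + 1) := by
        rw [max_le_iff]
        constructor
        · intro h; exact ⟨h0, by linarith⟩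
        · intro h; linarith [h.2]
      rw [h3, ← h2]
      constructor
      · intro h
        refine ⟨?_, fun l h1 hl => ?_⟩
        · have := h k le_rfl (by omega)
          simp only [Nat.sub_self, startFrom] at this
          linarith
        · have := h l (by omega) hl
          have e : l - k = (l - (k + 1)) + 1 := by omega
          rwa [e, startFrom_succ_shift] at this
      · rintro ⟨hA, hB⟩ l h1 hl
        rcases Nat.eq_or_lt_of_le h1 with h | h
        · subst h
          simp only [Nat.sub_self, startFrom]
          linarith
        · have e : l - k = (l - (k + 1)) + 1 := by omega
          rw [e, startFrom_succ_shift]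
          exact hB l h hl
  exact (key (n - 1 - k) k (by omega)).2 δ hδ
end

section
/- Assume the schedule generated by a₁ is feasible and define MaxShift by the backward recursion MaxShift_n = C_n − z_n and MaxShift_k = min(C_k − z_k, Wait_{k+1} + MaxShift_{k+1}) for k < n. Fix k and δ ≥ 0, and consider the schedule obtained by increasing the arrival time at visit k to a_k + δ and propagating forward (a'_{l+1} = max(a'_l, O_l) + T_l + t_l for l ≥ k). Then max(a'_l, O_l) ≤ C_l holds for every l ≥ k if and only if δ ≤ Wait_k + MaxShift_k. -/
/-- Arrival times propagated forward from visit `k`: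
`arrivalFrom O T t k v m` is the arrival time `a'_{k+m}` of the schedule in which
the arrival time at visit `k` is forced to `v` and later visits follow the
recursion `a'_{l+1} = max(a'_l, O_l) + T_l + t_l`. -/
noncomputable def arrivalFrom (O T t : ℕ → ℝ) (k : ℕ) (v : ℝ) : ℕ → ℝ
  | 0 => v
  | m + 1 => max (arrivalFrom O T t k v m) (O (k + m)) + T (k + m) + t (k + m)

theorem arrivalFrom_shift (O T t : ℕ → ℝ) (k : ℕ) (v : ℝ) (m : ℕ) :
    arrivalFrom O T t k v (m + 1)
      = arrivalFrom O T t (k + 1) (max v (O k) + T k + t k) m := by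
  induction m with
  | zero => simp [arrivalFrom]
  | succ m ih =>
    rw [arrivalFrom, ih, arrivalFrom]
    have : k + (m + 1) = k + 1 + m := by omega
    rw [this]

theorem shift_iff (a o δ M : ℝ) (hδ : 0 ≤ δ) (hM : 0 ≤ M) :
    max (a + δ) o - max a o ≤ M ↔ δ ≤ max 0 (o - a) + M := by
  rcases le_total a o with h | h
  · rw [max_eq_right h, max_eq_right (sub_nonneg.2 h), sub_le_iff_le_add, max_le_iff]
    constructor
    · rintro ⟨h1, _⟩; linarith
    · intro h1; constructor <;> linarith
  · rw [max_eq_left h, max_eq_left (sub_nonpos.2 h), max_eq_left (by linarith)]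
    constructor <;> intro h1 <;> linarith

/-- Increasing the arrival time at visit `k` by `δ ≥ 0` and propagating forward
keeps all later visits within their time windows if and only if
`δ ≤ Wait_k + MaxShift_k`, where `MaxShift` is given by the backward recursion
`MaxShift_{n-1} = C_{n-1} − z_{n-1}`,
`MaxShift_k = min(C_k − z_k, Wait_{k+1} + MaxShift_{k+1})`. -/
theorem arrival_delay_feasibility_iff
    (n : ℕ) (hn : 1 ≤ n) (O C T t : ℕ → ℝ)
    (hT : ∀ k, 0 ≤ T k) (ht : ∀ k, 0 ≤ t k) (a1 : ℝ)
    (hfeas : ∀ k, k < n → max (arrival O T t a1 k) (O k) ≤ C k)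
    (MS : ℕ → ℝ)
    (hMSlast : MS (n - 1) =
      C (n - 1) - max (arrival O T t a1 (n - 1)) (O (n - 1)))
    (hMSrec : ∀ j, j + 1 < n →
      MS j = min (C j - max (arrival O T t a1 j) (O j))
        (max 0 (O (j + 1) - arrival O T t a1 (j + 1)) + MS (j + 1)))
    (k : ℕ) (hk : k < n) (δ : ℝ) (hδ : 0 ≤ δ) :
    (∀ l, k ≤ l → l < n →
        max (arrivalFrom O T t k (arrival O T t a1 k + δ) (l - k)) (O l) ≤ C l)
      ↔ δ ≤ max 0 (O k - arrival O T t a1 k) + MS k := by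
  obtain ⟨d, hd⟩ : ∃ d, k + d + 1 = n := ⟨n - 1 - k, by omega⟩
  suffices H : ∀ d k, k + d + 1 = n → 0 ≤ MS k ∧ ∀ δ, 0 ≤ δ →
      ((∀ l, k ≤ l → l < n →
        max (arrivalFrom O T t k (arrival O T t a1 k + δ) (l - k)) (O l) ≤ C l)
      ↔ δ ≤ max 0 (O k - arrival O T t a1 k) + MS k) from (H d k hd).2 δ hδ
  clear hd hδ δ hk d k
  intro d
  induction d with
  | zero =>
    intro k hk
    have hkn : n - 1 = k := by omega
    rw [hkn] at hMSlast
    have hf := hfeas k (by omega)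
    have hM : 0 ≤ MS k := by rw [hMSlast]; linarith
    refine ⟨hM, fun δ hδ => ?_⟩
    rw [← shift_iff _ _ _ _ hδ hM, hMSlast, sub_le_sub_iff_right]
    constructor
    · intro h
      simpa [arrivalFrom] using h k le_rfl (by omega)
    · intro h l h1 h2
      obtain rfl : l = k := by omega
      simpa [arrivalFrom] using h
  | succ d ih =>
    intro k hk
    obtain ⟨hM1, ih⟩ := ih (k + 1) (by omega)
    have hr := hMSrec k (by omega)
    have hf := hfeas k (by omega)
    have hM : 0 ≤ MS k := by
      rw [hr]
      exact le_min (by linarith) (add_nonneg (le_max_left _ _) hM1)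
    refine ⟨hM, fun δ hδ => ?_⟩
    rw [← shift_iff _ _ _ _ hδ hM, hr, le_min_iff, sub_le_sub_iff_right]
    have hδ' : 0 ≤ max (arrival O T t a1 k + δ) (O k) - max (arrival O T t a1 k) (O k) :=
      sub_nonneg.2 (max_le_max (by linarith) le_rfl)
    rw [← ih _ hδ']
    have he : arrival O T t a1 (k + 1) +
        (max (arrival O T t a1 k + δ) (O k) - max (arrival O T t a1 k) (O k))
        = max (arrival O T t a1 k + δ) (O k) + T k + t k := by
      rw [arrival]; ring
    rw [he]
    constructor
    · intro h
      refine ⟨by simpa [arrivalFrom] using h k le_rfl (by omega), fun l h1 h2 => ?_⟩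
      have := h l (by omega) h2
      rwa [show l - k = (l - (k + 1)) + 1 by omega, arrivalFrom_shift] at this
    · rintro ⟨h0, h⟩ l h1 h2
      rcases Nat.eq_or_lt_of_le h1 with rfl | h3
      · simpa [arrivalFrom] using h0
      · rw [show l - k = (l - (k + 1)) + 1 by omega, arrivalFrom_shift]
        exact h l h3 h2
end

section
/- Define MaxShift by the backward recursion MaxShift_n = C_n − z_n and MaxShift_k = min(C_k − z_k, Wait_{k+1} + MaxShift_{k+1}) for k < n. Then for every k = 1,…,n the recursion has the closed form MaxShift_k = min_{k ≤ l ≤ n} ( C_l − z_l + Σ_{j=k+1}^{l} Wait_j ), where the empty sum (l = k) is 0. -/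
theorem maxShift_aux (m : ℕ) (D W MS : ℕ → ℝ) (hl : MS m = D m)
    (hr : ∀ j, j < m → MS j = min (D j) (W (j + 1) + MS (j + 1))) (d : ℕ) :
    ∀ k, k + d = m →
      (∀ l, k ≤ l → l ≤ m → MS k ≤ D l + ∑ j ∈ Finset.Icc (k + 1) l, W j) ∧
      ∃ l, k ≤ l ∧ l ≤ m ∧ D l + ∑ j ∈ Finset.Icc (k + 1) l, W j = MS k := by
  induction d with
  | zero =>
    intro k hk
    obtain rfl : k = m := by omega
    refine ⟨fun l h1 h2 => ?_, k, le_rfl, le_rfl, ?_⟩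
    · obtain rfl : l = k := by omega
      simp [hl]
    · simp [hl]
  | succ d ih =>
    intro k hk
    obtain ⟨hle, l₀, h1, h2, h3⟩ := ih (k + 1) (by omega)
    have hrk := hr k (by omega)
    have hs : ∀ l, k + 1 ≤ l → ∑ j ∈ Finset.Icc (k + 1) l, W j
        = W (k + 1) + ∑ j ∈ Finset.Icc (k + 1 + 1) l, W j := by
      intro l hl
      rw [← Finset.insert_Icc_add_one_left_eq_Icc hl, Finset.sum_insert (by simp)]
    constructor
    · intro l hkl hlm
      rcases Nat.eq_or_lt_of_le hkl with rfl | hlt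
      · simp [hrk]
      · rw [hs l hlt, hrk]
        have := hle l hlt hlm
        have := min_le_right (D k) (W (k + 1) + MS (k + 1))
        linarith
    · rcases min_choice (D k) (W (k + 1) + MS (k + 1)) with h | h
      · exact ⟨k, le_rfl, by omega, by simp [hrk, h]⟩
      · refine ⟨l₀, by omega, h2, ?_⟩
        rw [hs l₀ h1, hrk, h]
        linarith

/-- Closed form of the backward recursion
`MaxShift_{n-1} = C_{n-1} − z_{n-1}`,
`MaxShift_k = min(C_k − z_k, Wait_{k+1} + MaxShift_{k+1})`:
for every visit `k`,
`MaxShift_k = min_{k ≤ l ≤ n-1} (C_l − z_l + Σ_{j=k+1}^{l} Wait_j)`. -/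
theorem maxShift_closed_form
    (n : ℕ) (hn : 1 ≤ n) (O C T t : ℕ → ℝ)
    (hT : ∀ k, 0 ≤ T k) (ht : ∀ k, 0 ≤ t k) (a1 : ℝ)
    (MS : ℕ → ℝ)
    (hMSlast : MS (n - 1) =
      C (n - 1) - max (arrival O T t a1 (n - 1)) (O (n - 1)))
    (hMSrec : ∀ j, j + 1 < n →
      MS j = min (C j - max (arrival O T t a1 j) (O j))
        (max 0 (O (j + 1) - arrival O T t a1 (j + 1)) + MS (j + 1)))
    (k : ℕ) (hk : k < n) :
    MS k =
      (Finset.Icc k (n - 1)).inf'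
        (Finset.nonempty_Icc.mpr (by omega))
        (fun l =>
          C l - max (arrival O T t a1 l) (O l) +
            ∑ j ∈ Finset.Icc (k + 1) l, max 0 (O j - arrival O T t a1 j)) := by
  obtain ⟨hle, l₀, h1, h2, h3⟩ := maxShift_aux (n - 1)
    (fun l => C l - max (arrival O T t a1 l) (O l))
    (fun j => max 0 (O j - arrival O T t a1 j)) MS hMSlast
    (fun j hj => hMSrec j (by omega)) (n - 1 - k) k (by omega)
  apply le_antisymm
  · refine Finset.le_inf' _ _ fun l hl => ?_
    rw [Finset.mem_Icc] at hl
    exact hle l hl.1 hl.2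
  · exact (Finset.inf'_le _ (Finset.mem_Icc.mpr ⟨h1, h2⟩)).trans h3.le
end

section
/- Assume the schedule generated by a₁ is feasible and define MaxShift by MaxShift_n = C_n − z_n and MaxShift_k = min(C_k − z_k, Wait_{k+1} + MaxShift_{k+1}). Insert a new visit j with data (O_j, C_j, T_j), T_j ≥ 0, between consecutive visits i and i+1 with travel times t_{i,j}, t_{j,i+1} ≥ 0 replacing t_i, and set Wait_j = max(0, O_j − (z_i + T_i + t_{i,j})) and Shift_j = t_{i,j} + Wait_j + T_j + t_{j,i+1} − t_i. Then the new schedule (with j inserted, all later travel times unchanged) satisfies all time-window constraints if and only if both conditions hold: (a) z_i + T_i + t_{i,j} + Wait_j ≤ C_j, and (b) Shift_j ≤ Wait_{i+1} + MaxShift_{i+1}. -/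
theorem suffix_feas (n : ℕ) (O C T t : ℕ → ℝ) (a1 : ℝ)
    (hfeas : ∀ k, k < n → max (arrival O T t a1 k) (O k) ≤ C k)
    (MS : ℕ → ℝ)
    (hMSlast : MS (n - 1) =
      C (n - 1) - max (arrival O T t a1 (n - 1)) (O (n - 1)))
    (hMSrec : ∀ j, j + 1 < n →
      MS j = min (C j - max (arrival O T t a1 j) (O j))
        (max 0 (O (j + 1) - arrival O T t a1 (j + 1)) + MS (j + 1)))
    (b : ℕ → ℝ) (d : ℕ) : ∀ k, k + d + 1 = n →
      (∀ m, k ≤ m → b (m + 1) = max (b m) (O m) + T m + t m) →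
      0 ≤ MS k ∧ ((∀ m, k ≤ m → m < n → max (b m) (O m) ≤ C m) ↔
        b k - arrival O T t a1 k ≤ max 0 (O k - arrival O T t a1 k) + MS k) := by
  have key : ∀ x y : ℝ, max 0 (y - x) = max x y - x := by
    intro x y
    rcases le_total x y with h | h
    · rw [max_eq_right (by linarith), max_eq_right h]
    · rw [max_eq_left (by linarith), max_eq_left h]; ring
  induction d with
  | zero =>
    intro k hk _
    have hk' : n - 1 = k := by omega
    rw [hk'] at hMSlast
    have hf := hfeas k (by omega)
    have hO := (max_le_iff.1 hf).2
    refine ⟨by linarith, ?_⟩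
    rw [key, hMSlast]
    constructor
    · intro h
      have := (max_le_iff.1 (h k le_rfl (by omega))).1
      linarith
    · intro h m h1 h2
      obtain rfl : m = k := by omega
      exact max_le (by linarith) hO
  | succ d ih =>
    intro k hk hb
    obtain ⟨h0, hiff⟩ := ih (k + 1) (by omega) (fun m hm => hb m (by omega))
    have hf := hfeas k (by omega)
    have hO := (max_le_iff.1 hf).2
    have hr := hMSrec k (by omega)
    have ha : arrival O T t a1 (k + 1)
      = max (arrival O T t a1 k) (O k) + T k + t k := rfl
    have hbk := hb k le_rfl
    have hW : 0 ≤ max 0 (O (k + 1) - arrival O T t a1 (k + 1)) := le_max_left _ _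
    have hz := le_max_right (arrival O T t a1 k) (O k)
    refine ⟨by rw [hr]; exact le_min (by linarith) (by linarith), ?_⟩
    have hsplit : (∀ m, k ≤ m → m < n → max (b m) (O m) ≤ C m) ↔
        (max (b k) (O k) ≤ C k ∧ ∀ m, k + 1 ≤ m → m < n → max (b m) (O m) ≤ C m) := by
      constructor
      · intro h
        exact ⟨h k le_rfl (by omega), fun m h1 h2 => h m (by omega) h2⟩
      · rintro ⟨h1, h2⟩ m h3 h4
        rcases Nat.eq_or_lt_of_le h3 with h | h
        · subst h; exact h1
        · exact h2 m h h4
    rw [hsplit, hiff, key (arrival O T t a1 k)]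
    generalize max 0 (O (k + 1) - arrival O T t a1 (k + 1)) = W at *
    rw [ha, hbk]
    constructor
    · rintro ⟨h1, h2⟩
      have h3 := le_max_left (b k) (O k)
      have : b k - max (arrival O T t a1 k) (O k) ≤ MS k := by
        rw [hr]; exact le_min (by linarith) (by linarith)
      linarith
    · intro h
      have h3 : b k - max (arrival O T t a1 k) (O k) ≤ MS k := by linarith
      rw [hr] at h3
      obtain ⟨h4, h5⟩ := le_min_iff.1 h3
      refine ⟨max_le (by linarith) hO, ?_⟩
      have : max (b k) (O k) ≤ max (arrival O T t a1 k) (O k) + (W + MS (k + 1)) :=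
        max_le (by linarith) (by linarith)
      linarith

/-- Feasibility of a (basic) insertion.  Assume the original schedule is
feasible and let `MaxShift` be given by the backward recursion.  Insert a new
visit `j` (data `Oj, Cj, Tj`) between consecutive visits `i` and `i+1`, with
travel times `tij, tji1 ≥ 0` replacing `t i` (all later travel times
unchanged); in the new data `O', C', T', t'` the new visit has index `i+1` and
the old visits `i+1, …, n-1` are shifted to `i+2, …, n`.  With
`Wait_j = max(0, O_j − (z_i + T_i + t_{i,j}))` and
`Shift_j = t_{i,j} + Wait_j + T_j + t_{j,i+1} − t_i`, the new schedule
satisfies all time-window constraints if and only if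
(a) `z_i + T_i + t_{i,j} + Wait_j ≤ C_j` and
(b) `Shift_j ≤ Wait_{i+1} + MaxShift_{i+1}`. -/
theorem insertion_feasibility_iff
    (n : ℕ) (O C T t : ℕ → ℝ)
    (hT : ∀ k, 0 ≤ T k) (ht : ∀ k, 0 ≤ t k) (a1 : ℝ)
    (hfeas : ∀ k, k < n → max (arrival O T t a1 k) (O k) ≤ C k)
    (MS : ℕ → ℝ)
    (hMSlast : MS (n - 1) =
      C (n - 1) - max (arrival O T t a1 (n - 1)) (O (n - 1)))
    (hMSrec : ∀ j, j + 1 < n →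
      MS j = min (C j - max (arrival O T t a1 j) (O j))
        (max 0 (O (j + 1) - arrival O T t a1 (j + 1)) + MS (j + 1)))
    (i : ℕ) (hi : i + 1 < n)
    (Oj Cj Tj tij tji1 : ℝ) (hTj : 0 ≤ Tj) (htij : 0 ≤ tij) (htji1 : 0 ≤ tji1)
    (Waitj Shiftj : ℝ)
    (hWaitj : Waitj =
      max 0 (Oj - (max (arrival O T t a1 i) (O i) + T i + tij)))
    (hShiftj : Shiftj = tij + Waitj + Tj + tji1 - t i)
    (O' C' T' t' : ℕ → ℝ)
    (hO' : ∀ m, O' m = if m ≤ i then O m else if m = i + 1 then Oj else O (m - 1))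
    (hC' : ∀ m, C' m = if m ≤ i then C m else if m = i + 1 then Cj else C (m - 1))
    (hT' : ∀ m, T' m = if m ≤ i then T m else if m = i + 1 then Tj else T (m - 1))
    (ht' : ∀ m, t' m =
      if m < i then t m else if m = i then tij
      else if m = i + 1 then tji1 else t (m - 1)) :
    (∀ m, m < n + 1 → max (arrival O' T' t' a1 m) (O' m) ≤ C' m) ↔
      (max (arrival O T t a1 i) (O i) + T i + tij + Waitj ≤ Cj ∧
        Shiftj ≤
          max 0 (O (i + 1) - arrival O T t a1 (i + 1)) + MS (i + 1)) := by
  have hpre : ∀ m, m ≤ i → arrival O' T' t' a1 m = arrival O T t a1 m := by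
    intro m
    induction m with
    | zero => intro _; rfl
    | succ m ih =>
      intro hm
      simp only [arrival]
      rw [ih (by omega), hO', hT', ht', if_pos (by omega), if_pos (by omega),
        if_pos (by omega)]
  have hj : arrival O' T' t' a1 (i + 1)
      = max (arrival O T t a1 i) (O i) + T i + tij := by
    simp only [arrival]
    rw [hpre i le_rfl, hO', hT', ht']
    simp
  have hOj : O' (i + 1) = Oj := by rw [hO']; simp
  have hCj : C' (i + 1) = Cj := by rw [hC']; simp
  have hTj' : T' (i + 1) = Tj := by rw [hT']; simp
  have htj' : t' (i + 1) = tji1 := by rw [ht']; simp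
  have hzj : max (arrival O' T' t' a1 (i + 1)) (O' (i + 1))
      = max (arrival O T t a1 i) (O i) + T i + tij + Waitj := by
    rw [hj, hOj, hWaitj]
    generalize max (arrival O T t a1 i) (O i) + T i + tij = x
    rw [← max_add_add_left]
    simp
  have hOs : ∀ m, i + 1 ≤ m → O' (m + 1) = O m := by
    intro m hm
    rw [hO', if_neg (by omega), if_neg (by omega)]; rfl
  have hCs : ∀ m, i + 1 ≤ m → C' (m + 1) = C m := by
    intro m hm
    rw [hC', if_neg (by omega), if_neg (by omega)]; rfl
  have hTs : ∀ m, i + 1 ≤ m → T' (m + 1) = T m := by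
    intro m hm
    rw [hT', if_neg (by omega), if_neg (by omega)]; rfl
  have hts : ∀ m, i + 1 ≤ m → t' (m + 1) = t m := by
    intro m hm
    rw [ht', if_neg (by omega), if_neg (by omega), if_neg (by omega)]; rfl
  obtain ⟨-, hiff⟩ := suffix_feas n O C T t a1 hfeas MS hMSlast hMSrec
    (fun m => arrival O' T' t' a1 (m + 1)) (n - (i + 2)) (i + 1) (by omega) (by
      intro m hm
      show max (arrival O' T' t' a1 (m + 1)) (O' (m + 1)) + T' (m + 1) + t' (m + 1) = _
      rw [hOs m hm, hTs m hm, hts m hm])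
  have hs : arrival O' T' t' a1 (i + 1 + 1) - arrival O T t a1 (i + 1) = Shiftj := by
    have e1 : arrival O' T' t' a1 (i + 1 + 1) =
      max (arrival O' T' t' a1 (i + 1)) (O' (i + 1)) + T' (i + 1) + t' (i + 1) := rfl
    have e2 : arrival O T t a1 (i + 1)
      = max (arrival O T t a1 i) (O i) + T i + t i := rfl
    rw [e1, e2, hzj, hTj', htj', hShiftj]; ring
  simp only [hs] at hiff
  rw [← hiff, ← hzj, ← hCj]
  constructor
  · intro h
    refine ⟨h (i + 1) (by omega), fun m h1 h2 => ?_⟩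
    have := h (m + 1) (by omega)
    rwa [hOs m h1, hCs m h1] at this
  · rintro ⟨h1, h2⟩ m hm
    rcases lt_trichotomy m (i + 1) with h | h | h
    · rw [hpre m (by omega), hO', hC', if_pos (by omega), if_pos (by omega)]
      exact hfeas m (by omega)
    · subst h; exact h1
    · obtain ⟨p, rfl⟩ : ∃ p, m = p + 1 := ⟨m - 1, by omega⟩
      rw [hOs p (by omega), hCs p (by omega)]
      exact h2 p (by omega) (by omega)
end

section
/- Fix k ≤ n and δ ≥ 0 and consider the schedule obtained by increasing the arrival at visit k to a_k + δ and propagating forward. Then the new start time of the last visit equals z'_n = z_n + max(0, δ − Σ_{l=k}^{n} Wait_l). (The start-time increase at the last visit is the part of the delay exceeding the total remaining waiting time, as used for the quantity Δ with cumulative waits 𝑊̄.) -/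
theorem delay_aux (a O d W : ℝ) (hW : 0 ≤ W) :
    max (a + max 0 (d - W)) O = max a O + max 0 (d - (W + max 0 (O - a))) := by
  grind

theorem start_aux (O T t : ℕ → ℝ) (a1 : ℝ) (k : ℕ) (δ : ℝ) (hδ : 0 ≤ δ) (m : ℕ) :
    max (arrivalFrom O T t k (arrival O T t a1 k + δ) m) (O (k + m)) =
      max (arrival O T t a1 (k + m)) (O (k + m)) +
        max 0 (δ - ∑ l ∈ Finset.Icc k (k + m), max 0 (O l - arrival O T t a1 l)) := by
  induction m with
  | zero =>
    have h := delay_aux (arrival O T t a1 k) (O k) δ 0 le_rfl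
    simpa [arrivalFrom, max_eq_right hδ] using h
  | succ m ih =>
    have hW : 0 ≤ ∑ l ∈ Finset.Icc k (k + m), max 0 (O l - arrival O T t a1 l) :=
      Finset.sum_nonneg fun _ _ => le_max_left _ _
    have h := delay_aux (arrival O T t a1 (k + m + 1)) (O (k + m + 1)) δ _ hW
    rw [← add_assoc, Finset.sum_Icc_succ_top (by omega), ← h, arrivalFrom, ih, arrival]
    congr 1
    ring

/-- Increasing the arrival at visit `k` by `δ ≥ 0` and propagating forward,
the new start time of the last visit equals
`z'_{n-1} = z_{n-1} + max(0, δ − Σ_{l=k}^{n-1} Wait_l)`: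
the start-time increase at the last visit is the part of the delay exceeding
the total remaining waiting time. -/
theorem last_start_time_after_delay
    (n : ℕ) (hn : 1 ≤ n) (O C T t : ℕ → ℝ)
    (hT : ∀ k, 0 ≤ T k) (ht : ∀ k, 0 ≤ t k) (a1 : ℝ)
    (k : ℕ) (hk : k < n) (δ : ℝ) (hδ : 0 ≤ δ) :
    max (arrivalFrom O T t k (arrival O T t a1 k + δ) (n - 1 - k)) (O (n - 1)) =
      max (arrival O T t a1 (n - 1)) (O (n - 1)) +
        max 0 (δ - ∑ l ∈ Finset.Icc k (n - 1),
          max 0 (O l - arrival O T t a1 l)) := by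
  have h := start_aux O T t a1 k δ hδ (n - 1 - k)
  rwa [show k + (n - 1 - k) = n - 1 by omega] at h
end

section
/- Fix k ≤ n and δ ≥ 0 and consider the schedule obtained by decreasing the arrival at visit k to a_k − δ and propagating forward. Define ME_k = min_{k ≤ l ≤ n} max(0, a_l − O_l). Then the new start time of the last visit equals z''_n = z_n − min(δ, ME_k). (ME_k is exactly the maximum decrease of the final start time propagated from visit k to the last visit.) -/
theorem step_aux (a O e : ℝ) (he : 0 ≤ e) :
    max (a - e) O = max a O - min e (max 0 (a - O)) := by
  rcases le_total a O with h | h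
  · rw [max_eq_right h, max_eq_right (by linarith), max_eq_left (by linarith : a - O ≤ 0),
      min_eq_right he, sub_zero]
  · rw [max_eq_left h, max_eq_right (by linarith : 0 ≤ a - O)]
    rcases le_total e (a - O) with h' | h'
    · rw [min_eq_left h', max_eq_left (by linarith)]
    · rw [min_eq_right h', max_eq_right (by linarith)]
      ring

theorem main_aux (O T t : ℕ → ℝ) (a1 : ℝ) (k : ℕ) (δ : ℝ) (hδ : 0 ≤ δ) (m : ℕ) :
    ∀ hne : (Finset.Icc k (k + m)).Nonempty,
    max (arrivalFrom O T t k (arrival O T t a1 k - δ) m) (O (k + m)) =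
      max (arrival O T t a1 (k + m)) (O (k + m)) -
        min δ ((Finset.Icc k (k + m)).inf' hne
            (fun l => max 0 (arrival O T t a1 l - O l))) := by
  induction m with
  | zero =>
    intro hne
    simp only [add_zero, Finset.Icc_self, Finset.inf'_singleton, arrivalFrom]
    exact step_aux _ _ _ hδ
  | succ m ih =>
    intro hne
    have hne' : (Finset.Icc k (k + m)).Nonempty := Finset.nonempty_Icc.mpr (by omega)
    have hset : Finset.Icc k (k + (m + 1)) = insert (k + (m + 1)) (Finset.Icc k (k + m)) := by
      ext x
      simp only [Finset.mem_Icc, Finset.mem_insert]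
      omega
    have hinf : (Finset.Icc k (k + (m + 1))).inf' hne
        (fun l => max 0 (arrival O T t a1 l - O l)) =
        min (max 0 (arrival O T t a1 (k + (m + 1)) - O (k + (m + 1))))
          ((Finset.Icc k (k + m)).inf' hne' (fun l => max 0 (arrival O T t a1 l - O l))) := by
      simp only [hset]
      exact Finset.inf'_insert hne' _
    have h0 : 0 ≤ (Finset.Icc k (k + m)).inf' hne'
        (fun l => max 0 (arrival O T t a1 l - O l)) :=
      Finset.le_inf' _ _ (fun _ _ => le_max_left _ _)
    have harr : arrivalFrom O T t k (arrival O T t a1 k - δ) (m + 1) =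
        arrival O T t a1 (k + (m + 1)) - min δ ((Finset.Icc k (k + m)).inf' hne'
            (fun l => max 0 (arrival O T t a1 l - O l))) := by
      rw [arrivalFrom, ih hne', ← add_assoc k m 1, arrival]
      ring
    rw [harr, step_aux _ _ _ (le_min hδ h0), hinf, min_assoc]
    congr 2
    exact min_comm _ _

/-- Decreasing the arrival at visit `k` by `δ ≥ 0` and propagating forward,
the new start time of the last visit equals `z''_{n-1} = z_{n-1} − min(δ, ME_k)`
where `ME_k = min_{k ≤ l ≤ n-1} max(0, a_l − O_l)`: `ME_k` is exactly the maximum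
decrease of the final start time propagated from visit `k` to the last visit. -/
theorem last_start_time_after_decrease
    (n : ℕ) (hn : 1 ≤ n) (O C T t : ℕ → ℝ)
    (hT : ∀ k, 0 ≤ T k) (ht : ∀ k, 0 ≤ t k) (a1 : ℝ)
    (k : ℕ) (hk : k < n) (δ : ℝ) (hδ : 0 ≤ δ) :
    max (arrivalFrom O T t k (arrival O T t a1 k - δ) (n - 1 - k)) (O (n - 1)) =
      max (arrival O T t a1 (n - 1)) (O (n - 1)) -
        min δ
          ((Finset.Icc k (n - 1)).inf' (Finset.nonempty_Icc.mpr (by omega))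
            (fun l => max 0 (arrival O T t a1 l - O l))) := by
  obtain ⟨m, rfl⟩ : ∃ m, n = k + m + 1 := ⟨n - 1 - k, by omega⟩
  have h1 : k + m + 1 - 1 - k = m := by omega
  rw [h1]
  exact main_aux O T t a1 k δ hδ m _
end

section
/- Let the schedule generated by a₁ be feasible and let 1 ≤ i < k ≤ n. Remove the block of visits i+1,…,k−1 and let t̂ ≥ 0 be the new travel time from visit i to visit k. If t̂ ≤ a_k − z_i − T_i (equivalently Shift_i := t̂ − (a_k − T_i − z_i) ≤ 0), then the reduced schedule visiting 1,…,i,k,…,n (arrival times recomputed by the same recursion with travel time t̂ between i and k and all other data unchanged) is feasible. -/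
/-- Removal of the block of visits `i+1, …, k-1` with new travel time
`t̂ ≥ 0` from visit `i` to visit `k`.  If `t̂ ≤ a_k − z_i − T_i`
(equivalently `Shift_i := t̂ − (a_k − T_i − z_i) ≤ 0`), then the reduced
schedule visiting `0, …, i, k, …, n-1` (arrival times recomputed by the same
recursion, with arrival at `k` equal to `z_i + T_i + t̂` and all other data
unchanged) is feasible, provided the original schedule was feasible. -/
theorem removal_feasibility
    (n : ℕ) (O C T t : ℕ → ℝ)
    (hT : ∀ k, 0 ≤ T k) (ht : ∀ k, 0 ≤ t k) (a1 : ℝ)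
    (hfeas : ∀ l, l < n → max (arrival O T t a1 l) (O l) ≤ C l)
    (i k : ℕ) (hik : i < k) (hk : k < n)
    (that : ℝ) (hthat0 : 0 ≤ that)
    (hthat : that ≤
      arrival O T t a1 k - max (arrival O T t a1 i) (O i) - T i) :
    (∀ l, l ≤ i → max (arrival O T t a1 l) (O l) ≤ C l) ∧
    (∀ l, k ≤ l → l < n →
      max (arrivalFrom O T t k
            (max (arrival O T t a1 i) (O i) + T i + that) (l - k)) (O l)
        ≤ C l) := by
  have key : ∀ m, arrivalFrom O T t k
      (max (arrival O T t a1 i) (O i) + T i + that) m ≤ arrival O T t a1 (k + m) := by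
    intro m
    induction m with
    | zero =>
      simp only [arrivalFrom, Nat.add_zero]
      linarith
    | succ m ih =>
      rw [← Nat.add_assoc]
      simp only [arrivalFrom, arrival]
      have := max_le_max_right (O (k + m)) ih
      linarith
  refine ⟨fun l hl => hfeas l (by omega), fun l hkl hl => ?_⟩
  have h := key (l - k)
  rw [Nat.add_sub_cancel' hkl] at h
  exact (max_le_max_right (O l) h).trans (hfeas l hl)
end

section
/- Fix k ≤ n and δ ≥ 0 and consider the schedule obtained by increasing the arrival at visit k to a_k + δ and propagating forward. If there is an index j with k ≤ j ≤ n such that Σ_{l=k}^{j} Wait_l ≥ δ, then a'_l = a_l and z'_l = z_l for every l > j. (Once the delay has been fully absorbed by waiting times, all later arrival and start times are unchanged; this justifies stopping the forward update of the itinerary as soon as the propagated shift becomes zero.) -/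
/-- The propagated shift is the part of the delay not yet absorbed by waiting. -/
lemma arrivalFrom_shift_s14 (O T t : ℕ → ℝ) (a1 : ℝ) (k : ℕ) (δ : ℝ) (hδ : 0 ≤ δ) (m : ℕ) :
    arrivalFrom O T t k (arrival O T t a1 k + δ) m = arrival O T t a1 (k + m) +
      max 0 (δ - ∑ i ∈ Finset.range m, max 0 (O (k + i) - arrival O T t a1 (k + i))) := by
  induction m with
  | zero => simp [arrivalFrom, hδ]
  | succ m ih =>
    rw [Finset.sum_range_succ, ← add_assoc k m 1]
    simp only [arrivalFrom, arrival]
    rw [ih]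
    generalize ∑ i ∈ Finset.range m, max 0 (O (k + i) - arrival O T t a1 (k + i)) = S
    generalize arrival O T t a1 (k + m) = a
    generalize O (k + m) = o
    rcases max_cases 0 (o - a) with h1 | h1 <;>
    rcases max_cases 0 (δ - S) with h2 | h2 <;>
    rcases max_cases a o with h3 | h3 <;>
    rw [h1.1, h2.1, h3.1] <;>
    simp only [max_def] <;> split_ifs <;> linarith

/-- Once a delay `δ ≥ 0` introduced at visit `k` has been fully absorbed by the
waiting times of visits `k, …, j` (i.e. `Σ_{l=k}^{j} Wait_l ≥ δ`), all later
arrival and start times are unchanged.  This justifies stopping the forward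
update of the itinerary as soon as the propagated shift becomes zero. -/
theorem delay_fully_absorbed_stops_propagation
    (n : ℕ) (hn : 1 ≤ n) (O C T t : ℕ → ℝ)
    (hT : ∀ k, 0 ≤ T k) (ht : ∀ k, 0 ≤ t k) (a1 : ℝ)
    (k : ℕ) (hk : k < n) (δ : ℝ) (hδ : 0 ≤ δ)
    (j : ℕ) (hkj : k ≤ j) (hj : j < n)
    (habs : δ ≤ ∑ l ∈ Finset.Icc k j, max 0 (O l - arrival O T t a1 l)) :
    ∀ l, j < l → l < n →
      arrivalFrom O T t k (arrival O T t a1 k + δ) (l - k) =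
        arrival O T t a1 l ∧
      max (arrivalFrom O T t k (arrival O T t a1 k + δ) (l - k)) (O l) =
        max (arrival O T t a1 l) (O l) := by
  intro l hjl hln
  have key : arrivalFrom O T t k (arrival O T t a1 k + δ) (l - k) = arrival O T t a1 l := by
    rw [arrivalFrom_shift_s14 O T t a1 k δ hδ, Nat.add_sub_cancel' (by omega : k ≤ l)]
    have h2 : ∑ i ∈ Finset.Icc k j, max 0 (O i - arrival O T t a1 i) ≤
        ∑ i ∈ Finset.Ico k l, max 0 (O i - arrival O T t a1 i) := by
      apply Finset.sum_le_sum_of_subset_of_nonneg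
      · intro x hx
        simp only [Finset.mem_Icc, Finset.mem_Ico] at *
        omega
      · intro i _ _
        exact le_max_left _ _
    rw [Finset.sum_Ico_eq_sum_range] at h2
    rw [max_eq_left (by linarith), add_zero]
  exact ⟨key, by rw [key]⟩
end

section
/- Advanced insertion feasibility. Let the schedule generated by a₁ be feasible, let 1 ≤ i < i+1 ≤ q < n, and modify the itinerary in two places: (1) insert a new visit j with data (O_j, C_j, T_j), T_j ≥ 0, between visits i and i+1, with travel times t_{i,j}, t_{j,i+1} ≥ 0 replacing t_i; (2) replace the travel time t_q from visit q to visit q+1 by t'_q ≥ 0. Set Wait_j = max(0, O_j − (z_i + T_i + t_{i,j})) and Shift_j = t_{i,j} + Wait_j + T_j + t_{j,i+1} − t_i. Define the segment quantities on visits i+1,…,q: the backward recursion ōMS_q = C_q − z_q, ōMS_l = min(C_l − z_l, Wait_{l+1} + ōMS_{l+1}) for i+1 ≤ l < q; Δ = max(0, Shift_j − Σ_{l=i+1}^{q} Wait_l) if Shift_j ≥ 0, and Δ = −min(−Shift_j, min_{i+1 ≤ l ≤ q} max(0, a_l − O_l)) if Shift_j < 0; and Shift_q = Δ + t'_q − t_q.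 Define MaxShift on the original schedule by MaxShift_n = C_n − z_n, MaxShift_k = min(C_k − z_k, Wait_{k+1} + MaxShift_{k+1}). Then the modified schedule (visiting 1,…,i, j, i+1,…,n with arrival times recomputed by the same recursion) satisfies all time-window constraints if and only if the following three conditions hold: (A) z_i + T_i + t_{i,j} + Wait_j ≤ C_j; (B) Shift_j ≤ Wait_{i+1} + ōMS_{i+1}; (C) Shift_q ≤ Wait_{q+1} + MaxShift_{q+1}. -/
/-- Feasibility of a shifted segment `p, …, p + m` against the backward slack recursion. -/
lemma segment_feasible_iff (O C T t a b z W S : ℕ → ℝ)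
    (hz : ∀ l, z l = max (a l) (O l)) (hW : ∀ l, W l = max 0 (O l - a l))
    (ha : ∀ l, a (l + 1) = z l + T l + t l) (m : ℕ) : ∀ p : ℕ,
    (∀ l, p ≤ l → l ≤ p + m → z l ≤ C l) →
    (∀ l, p ≤ l → l < p + m → b (l + 1) = max (b l) (O l) + T l + t l) →
    S (p + m) = C (p + m) - z (p + m) →
    (∀ l, p ≤ l → l < p + m → S l = min (C l - z l) (W (l + 1) + S (l + 1))) →
    0 ≤ S p ∧ ((∀ l, p ≤ l → l ≤ p + m → max (b l) (O l) ≤ C l) ↔ b p - a p ≤ W p + S p) := by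
  have hWz : ∀ l, W l = z l - a l := by
    intro l
    rw [hW, hz, max_sub_sub_right (a l) (O l) (a l) |>.symm, sub_self]
  have hOz : ∀ l, O l ≤ z l := fun l => by rw [hz]; exact le_max_right _ _
  have hW0 : ∀ l, 0 ≤ W l := fun l => by rw [hW]; exact le_max_left _ _
  induction m with
  | zero =>
    intro p hf hb hS hr
    have h1 := hf p le_rfl le_rfl
    simp only [add_zero] at hS
    refine ⟨by linarith, ?_⟩
    rw [hWz, hS]
    constructor
    · intro h
      have := (max_le_iff.1 (h p le_rfl le_rfl)).1
      linarith
    · intro h l h2 h3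
      obtain rfl : l = p := by omega
      exact max_le (by linarith) (by linarith [hOz l])
  | succ m ih =>
    intro p hf hb hS hr
    have e : p + 1 + m = p + (m + 1) := by omega
    obtain ⟨h0, h1⟩ := ih (p + 1) (fun l _ _ => hf l (by omega) (by omega))
      (fun l _ _ => hb l (by omega) (by omega)) (by rw [e]; exact hS)
      (fun l _ _ => hr l (by omega) (by omega))
    have hfp := hf p le_rfl (by omega)
    have hrp := hr p le_rfl (by omega)
    have hbp := hb p le_rfl (by omega)
    have hw := hW0 (p + 1)
    have ho := hOz p
    refine ⟨by rw [hrp]; exact le_min (by linarith) (by linarith), ?_⟩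
    have key : (∀ l, p ≤ l → l ≤ p + (m + 1) → max (b l) (O l) ≤ C l) ↔
        (max (b p) (O p) ≤ C p ∧
          ∀ l, p + 1 ≤ l → l ≤ p + 1 + m → max (b l) (O l) ≤ C l) := by
      constructor
      · intro h
        exact ⟨h p le_rfl (by omega), fun l _ _ => h l (by omega) (by omega)⟩
      · rintro ⟨h2, h3⟩ l h4 h5
        rcases Nat.eq_or_lt_of_le h4 with h6 | h6
        · rw [← h6]; exact h2
        · exact h3 l h6 (by omega)
    rw [key, h1, hbp, ha, hWz p, hrp]
    constructor
    · rintro ⟨h2, h3⟩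
      have h4 := le_max_left (b p) (O p)
      have : z p - a p + min (C p - z p) (W (p + 1) + S (p + 1)) ≥ z p - a p + (b p - z p) := by
        have := le_min (show b p - z p ≤ C p - z p by linarith)
          (show b p - z p ≤ W (p + 1) + S (p + 1) by linarith)
        linarith
      linarith
    · intro h
      have h2 := min_le_left (C p - z p) (W (p + 1) + S (p + 1))
      have h3 := min_le_right (C p - z p) (W (p + 1) + S (p + 1))
      refine ⟨max_le (by linarith) (by linarith), ?_⟩
      have : max (b p) (O p) ≤ z p + (W (p + 1) + S (p + 1)) :=
        max_le (by linarith) (by linarith)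
      linarith

/-- Propagation of a nonnegative shift. -/
lemma shift_nonneg (O T t a b z W : ℕ → ℝ)
    (hz : ∀ l, z l = max (a l) (O l)) (hW : ∀ l, W l = max 0 (O l - a l))
    (ha : ∀ l, a (l + 1) = z l + T l + t l) (p q : ℕ) (hpq : p ≤ q)
    (hd : 0 ≤ b p - a p)
    (hb : ∀ l, p ≤ l → l < q → b (l + 1) = max (b l) (O l) + T l + t l) :
    max (b q) (O q) - z q = max 0 (b p - a p - ∑ l ∈ Finset.Icc p q, W l) := by
  have step : ∀ l, 0 ≤ b l - a l → max (b l) (O l) - z l = max 0 (b l - a l - W l) := by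
    intro l h
    rw [hz, hW]
    grind
  induction q, hpq using Nat.le_induction with
  | base => simpa using step p hd
  | succ q hq ih =>
    have ih := ih (fun l h1 h2 => hb l h1 (by omega))
    have hbq := hb q hq (by omega)
    have hs : b (q + 1) - a (q + 1) = max 0 (b p - a p - ∑ l ∈ Finset.Icc p q, W l) := by
      rw [← ih, hbq, ha]; ring
    have hw : 0 ≤ W (q + 1) := by rw [hW]; exact le_max_left _ _
    rw [step _ (by rw [hs]; exact le_max_left _ _), hs, Finset.sum_Icc_succ_top (by omega)]
    grind

/-- Propagation of a negative shift. -/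
lemma shift_neg (O T t a b z : ℕ → ℝ)
    (hz : ∀ l, z l = max (a l) (O l))
    (ha : ∀ l, a (l + 1) = z l + T l + t l) (p q : ℕ) (hpq : p ≤ q)
    (hd : b p - a p ≤ 0)
    (hb : ∀ l, p ≤ l → l < q → b (l + 1) = max (b l) (O l) + T l + t l) :
    max (b q) (O q) - z q ≤ 0 ∧ ∀ x, x ≤ -(max (b q) (O q) - z q) ↔
      (x ≤ -(b p - a p) ∧ ∀ l, p ≤ l → l ≤ q → x ≤ max 0 (a l - O l)) := by
  have step : ∀ l, b l - a l ≤ 0 →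
      -(max (b l) (O l) - z l) = min (-(b l - a l)) (max 0 (a l - O l)) := by
    intro l h
    rw [hz]
    grind
  have step0 : ∀ l, b l - a l ≤ 0 → max (b l) (O l) - z l ≤ 0 := by
    intro l h
    rw [hz]
    grind
  induction q, hpq using Nat.le_induction with
  | base =>
    refine ⟨step0 p hd, fun x => ?_⟩
    rw [step p hd, le_min_iff]
    refine and_congr_right fun _ => ⟨fun h l h1 h2 => ?_, fun h => h p le_rfl le_rfl⟩
    obtain rfl : l = p := by omega
    exact h
  | succ q hq ih =>
    obtain ⟨ih0, ih⟩ := ih (fun l h1 h2 => hb l h1 (by omega))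
    have hbq := hb q hq (by omega)
    have hs : b (q + 1) - a (q + 1) = max (b q) (O q) - z q := by
      rw [hbq, ha]; ring
    have hs0 : b (q + 1) - a (q + 1) ≤ 0 := by rw [hs]; exact ih0
    refine ⟨step0 _ hs0, fun x => ?_⟩
    rw [step _ hs0, le_min_iff, hs, ih, and_assoc]
    refine and_congr_right fun _ => ⟨?_, ?_⟩
    · rintro ⟨h1, h2⟩ l h3 h4
      rcases Nat.eq_or_lt_of_le h4 with h5 | h5
      · rw [h5]; exact h2
      · exact h1 l h3 (by omega)
    · intro h
      exact ⟨fun l h1 h2 => h l h1 (by omega), h _ (by omega) le_rfl⟩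

/-- Advanced insertion feasibility.  The original schedule (visits `0, …, n-1`,
generated by `a₁`) is feasible.  The itinerary is modified in two places:
(1) a new visit `j` (data `Oj, Cj, Tj`) is inserted between visits `i` and
`i+1`, with travel times `tij, tji1 ≥ 0` replacing `t i`;
(2) the travel time `t q` from visit `q` to visit `q+1` is replaced by `t'q ≥ 0`.
In the modified data `O', C', T', t'` the new visit has index `i+1` and the old
visits `i+1, …, n-1` are shifted to `i+2, …, n` (so the travel time out of old
visit `q`, new index `q+1`, is `t'q`).
With `z_l = max(a_l, O_l)`, `Wait_l = max(0, O_l − a_l)`,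
`Wait_j = max(0, O_j − (z_i + T_i + t_{i,j}))`,
`Shift_j = t_{i,j} + Wait_j + T_j + t_{j,i+1} − t_i`, the segment quantities on
visits `i+1, …, q` given by the backward recursion `ōMS_q = C_q − z_q`,
`ōMS_l = min(C_l − z_l, Wait_{l+1} + ōMS_{l+1})`,
`Δ = max(0, Shift_j − Σ_{l=i+1}^{q} Wait_l)` if `Shift_j ≥ 0` and
`Δ = −min(−Shift_j, min_{i+1 ≤ l ≤ q} max(0, a_l − O_l))` otherwise,
`Shift_q = Δ + t'_q − t_q`, and `MaxShift` on the original schedule given by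
`MaxShift_{n-1} = C_{n-1} − z_{n-1}`,
`MaxShift_k = min(C_k − z_k, Wait_{k+1} + MaxShift_{k+1})`,
the modified schedule satisfies all time-window constraints if and only if
(A) `z_i + T_i + t_{i,j} + Wait_j ≤ C_j`,
(B) `Shift_j ≤ Wait_{i+1} + ōMS_{i+1}`, and
(C) `Shift_q ≤ Wait_{q+1} + MaxShift_{q+1}`. -/
theorem advanced_insertion_feasibility_iff
    (n : ℕ) (O C T t : ℕ → ℝ)
    (hT : ∀ k, 0 ≤ T k) (ht : ∀ k, 0 ≤ t k) (a1 : ℝ)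
    (z W : ℕ → ℝ)
    (hz : ∀ l, z l = max (arrival O T t a1 l) (O l))
    (hW : ∀ l, W l = max 0 (O l - arrival O T t a1 l))
    (hfeas : ∀ l, l < n → z l ≤ C l)
    (i q : ℕ) (hiq : i < q) (hq : q + 1 < n)
    (Oj Cj Tj tij tji1 : ℝ) (hTj : 0 ≤ Tj) (htij : 0 ≤ tij) (htji1 : 0 ≤ tji1)
    (t'q : ℝ) (ht'q : 0 ≤ t'q)
    (Waitj Shiftj : ℝ)
    (hWaitj : Waitj = max 0 (Oj - (z i + T i + tij)))
    (hShiftj : Shiftj = tij + Waitj + Tj + tji1 - t i)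
    (oMS : ℕ → ℝ)
    (hoMSq : oMS q = C q - z q)
    (hoMSrec : ∀ l, i + 1 ≤ l → l < q →
      oMS l = min (C l - z l) (W (l + 1) + oMS (l + 1)))
    (Δ Shiftq : ℝ)
    (hΔ : Δ =
      if 0 ≤ Shiftj then
        max 0 (Shiftj - ∑ l ∈ Finset.Icc (i + 1) q, W l)
      else
        -(min (-Shiftj)
          ((Finset.Icc (i + 1) q).inf' (Finset.nonempty_Icc.mpr (by omega))
            (fun l => max 0 (arrival O T t a1 l - O l)))))
    (hShiftq : Shiftq = Δ + t'q - t q)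
    (MS : ℕ → ℝ)
    (hMSlast : MS (n - 1) = C (n - 1) - z (n - 1))
    (hMSrec : ∀ k, k + 1 < n →
      MS k = min (C k - z k) (W (k + 1) + MS (k + 1)))
    (O' C' T' t' : ℕ → ℝ)
    (hO' : ∀ m, O' m = if m ≤ i then O m else if m = i + 1 then Oj else O (m - 1))
    (hC' : ∀ m, C' m = if m ≤ i then C m else if m = i + 1 then Cj else C (m - 1))
    (hT' : ∀ m, T' m = if m ≤ i then T m else if m = i + 1 then Tj else T (m - 1))
    (ht' : ∀ m, t' m =
      if m < i then t m else if m = i then tij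
      else if m = i + 1 then tji1
      else if m = q + 1 then t'q else t (m - 1)) :
    (∀ m, m < n + 1 → max (arrival O' T' t' a1 m) (O' m) ≤ C' m) ↔
      (z i + T i + tij + Waitj ≤ Cj ∧
        Shiftj ≤ W (i + 1) + oMS (i + 1) ∧
        Shiftq ≤ W (q + 1) + MS (q + 1)) := by
  obtain ⟨a, haa⟩ : ∃ a, a = arrival O T t a1 := ⟨_, rfl⟩
  obtain ⟨a', haa'⟩ : ∃ a', a' = arrival O' T' t' a1 := ⟨_, rfl⟩
  have ha : ∀ l, a (l + 1) = z l + T l + t l := by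
    intro l; rw [hz, haa]; rfl
  have ha' : ∀ l, a' (l + 1) = max (a' l) (O' l) + T' l + t' l := by
    intro l; rw [haa']; rfl
  have h00 : a' 0 = a 0 := by rw [haa, haa']; rfl
  rw [← haa']
  rw [← haa] at hΔ
  simp only [← haa] at hz hW
  have hpre : ∀ l, l ≤ i → a' l = a l := by
    intro l
    induction l with
    | zero => intro _; exact h00
    | succ l ih =>
      intro h
      rw [ha', ha, hz, ih (by omega), hO', hT', ht', if_pos (by omega), if_pos (by omega),
        if_pos (by omega)]
  have hj : a' (i + 1) = z i + T i + tij := by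
    rw [ha', hz, hpre i le_rfl, hO', hT', ht']
    simp
  have hOj : O' (i + 1) = Oj := by rw [hO']; simp
  have hCj : C' (i + 1) = Cj := by rw [hC']; simp
  have hmj : max (a' (i + 1)) (O' (i + 1)) = z i + T i + tij + Waitj := by
    rw [hj, hOj, hWaitj]
    grind
  obtain ⟨b, hbdef⟩ : ∃ b : ℕ → ℝ, ∀ l, b l = a' (l + 1) := ⟨fun l => a' (l + 1), fun _ => rfl⟩
  have hOs : ∀ l, i + 1 ≤ l → O' (l + 1) = O l := by
    intro l h; rw [hO', if_neg (by omega), if_neg (by omega)]; rfl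
  have hCs : ∀ l, i + 1 ≤ l → C' (l + 1) = C l := by
    intro l h; rw [hC', if_neg (by omega), if_neg (by omega)]; rfl
  have hTs : ∀ l, i + 1 ≤ l → T' (l + 1) = T l := by
    intro l h; rw [hT', if_neg (by omega), if_neg (by omega)]; rfl
  have hts : ∀ l, i + 1 ≤ l → l ≠ q → t' (l + 1) = t l := by
    intro l h h2
    rw [ht', if_neg (by omega), if_neg (by omega), if_neg (by omega), if_neg (by omega)]; rfl
  have htq : t' (q + 1) = t'q := by
    rw [ht', if_neg (by omega), if_neg (by omega), if_neg (by omega), if_pos rfl]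
  have hb : ∀ l, i + 1 ≤ l → l ≠ q → b (l + 1) = max (b l) (O l) + T l + t l := by
    intro l h h2
    rw [hbdef, hbdef, ha', hOs l h, hTs l h, hts l h h2]
  have hbq : b (q + 1) = max (b q) (O q) + T q + t'q := by
    rw [hbdef, hbdef, ha', hOs q hiq, hTs q hiq, htq]
  have hd : b (i + 1) - a (i + 1) = Shiftj := by
    have h1 : T' (i + 1) = Tj := by rw [hT']; simp
    have h2 : t' (i + 1) = tji1 := by rw [ht']; simp
    rw [hbdef, ha', hmj, h1, h2, ha, hShiftj]; ring
  have hΔe : max (b q) (O q) - z q = Δ := by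
    rw [hΔ]
    split_ifs with hs
    · rw [← hd] at hs ⊢
      exact shift_nonneg O T t a b z W hz hW ha (i + 1) q hiq hs
        (fun l h1 h2 => hb l h1 (by omega))
    · rw [← hd] at hs ⊢
      have h := (shift_neg O T t a b z hz ha (i + 1) q hiq (le_of_not_ge hs)
        (fun l h1 h2 => hb l h1 (by omega))).2
      rw [eq_comm, neg_eq_iff_eq_neg]
      refine eq_of_forall_le_iff fun x => ?_
      rw [h, le_min_iff, Finset.le_inf'_iff]
      simp only [Finset.mem_Icc, and_imp]
  have hdq : b (q + 1) - a (q + 1) = Shiftq := by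
    rw [hbq, ha, hShiftq, ← hΔe]; ring
  obtain ⟨m, hm⟩ : ∃ m, q = i + 1 + m := ⟨q - (i + 1), by omega⟩
  obtain ⟨r, hr⟩ : ∃ r, n - 1 = q + 1 + r := ⟨n - 1 - (q + 1), by omega⟩
  have hB := (segment_feasible_iff O C T t a b z W oMS hz hW ha m (i + 1)
    (fun l _ _ => hfeas l (by omega)) (fun l _ _ => hb l (by omega) (by omega))
    (by rw [← hm]; exact hoMSq) (fun l _ _ => hoMSrec l (by omega) (by omega))).2
  have hC := (segment_feasible_iff O C T t a b z W MS hz hW ha r (q + 1)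
    (fun l _ _ => hfeas l (by omega)) (fun l _ _ => hb l (by omega) (by omega))
    (by rw [← hr]; exact hMSlast) (fun l _ _ => hMSrec l (by omega))).2
  rw [hd] at hB
  rw [hdq] at hC
  rw [← hB, ← hC, ← hmj, ← hCj]
  constructor
  · intro h
    refine ⟨h _ (by omega), fun l h1 h2 => ?_, fun l h1 h2 => ?_⟩
    · rw [hbdef, ← hOs l (by omega), ← hCs l (by omega)]
      exact h _ (by omega)
    · rw [hbdef, ← hOs l (by omega), ← hCs l (by omega)]
      exact h _ (by omega)
  · rintro ⟨hA, hB', hC''⟩ k hk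
    rcases Nat.lt_trichotomy k (i + 1) with h | h | h
    · rw [hpre k (by omega), hO', hC', if_pos (by omega), if_pos (by omega), ← hz]
      exact hfeas k (by omega)
    · rw [h]; exact hA
    · obtain ⟨l, rfl⟩ : ∃ l, k = l + 1 := ⟨k - 1, by omega⟩
      rw [← hbdef, hOs l (by omega), hCs l (by omega)]
      rcases Nat.lt_or_ge q l with h2 | h2
      · exact hC'' l (by omega) (by omega)
      · exact hB' l (by omega) (by omega)
end
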